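/- Assume |ρ| < 1 and χ(0) > 0. Then u_− < 0, and for every u ∈ (u_−, 0): one has 0 < γ(u) < χ(u); for every t > 0, f_t(u) = 0 if and only if t = F(u), where F(u) := (2/γ(u))·artanh(γ(u)/χ(u)); and F(u) → +∞ as u increases to 0. -/

import Mathlib

open Real Set Filter Topology

/-- For `0 < g < c`, the only zero of `cosh x - (c / g) * sinh x` is `artanh (g / c)`. -/
lemma cosh_sub_div_mul_sinh_eq_zero_iff {g c x : ℝ} (hg : 0 < g) (hgc : g < c) :
    Real.cosh x - c / g * Real.sinh x = 0 ↔
      x = 1 / 2 * Real.log ((1 + g / c) / (1 - g / c)) := by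
  have hc : 0 < c := hg.trans hgc
  have hr0 : 0 < g / c := div_pos hg hc
  have hr1 : g / c < 1 := (div_lt_one hc).2 hgc
  have hr : g / c ∈ Ioo (-1 : ℝ) 1 := ⟨by linarith, hr1⟩
  rw [← Real.artanh_eq_half_log (Ioo_subset_Icc_self hr)]
  have hcosh := Real.cosh_pos x
  have key : Real.cosh x - c / g * Real.sinh x = 0 ↔ Real.tanh x = g / c := by
    rw [Real.tanh_eq_sinh_div_cosh, div_eq_div_iff hcosh.ne' hc.ne', sub_eq_zero,
      div_mul_eq_mul_div, eq_div_iff hg.ne']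
    constructor <;> intro h <;> linarith
  rw [key]
  constructor
  · intro h
    rw [← h, Real.artanh_tanh]
  · rintro rfl
    exact Real.tanh_artanh hr

/-- Between the lower root and `0` the quadratic `-s²k u² + s m u + β²` is positive. -/
lemma quadratic_pos_of_lower_root_lt {s k m β u : ℝ} (hs : 0 < s) (hk : 0 < k)
    (hu : (m - Real.sqrt (m ^ 2 + 4 * β ^ 2 * k)) / (2 * s * k) < u) (hu0 : u < 0) :
    0 < -(s ^ 2 * k) * u ^ 2 + s * m * u + β ^ 2 := by
  have hD : 0 ≤ m ^ 2 + 4 * β ^ 2 * k := by positivity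
  have hmD : |m| ≤ Real.sqrt (m ^ 2 + 4 * β ^ 2 * k) :=
    Real.abs_le_sqrt (by nlinarith [mul_nonneg (sq_nonneg β) hk.le])
  have hsk : 0 < 2 * s * k := by positivity
  have hl := (div_lt_iff₀ hsk).1 hu
  have hneg : u * (2 * s * k) < 0 := mul_neg_of_neg_of_pos hu0 hsk
  have hsq : (u * (2 * s * k) - m) ^ 2 < Real.sqrt (m ^ 2 + 4 * β ^ 2 * k) ^ 2 :=
    sq_lt_sq' (by linarith) (by linarith [neg_abs_le m])
  rw [Real.sq_sqrt hD] at hsq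
  have h4 : 0 < 4 * k * (-(s ^ 2 * k) * u ^ 2 + s * m * u + β ^ 2) := by nlinarith
  exact pos_of_mul_pos_right h4 (by positivity)

lemma lower_root_neg {s k m β : ℝ} (hs : 0 < s) (hk : 0 < k) (hβ : 0 < β) :
    (m - Real.sqrt (m ^ 2 + 4 * β ^ 2 * k)) / (2 * s * k) < 0 := by
  refine div_neg_of_neg_of_pos (sub_neg.2 (Real.lt_sqrt_of_sq_lt ?_)) (by positivity)
  have : 0 < 4 * β ^ 2 * k := by positivity
  linarith

/-- if |ρ| < 1 and χ(0) > 0 then u₋ < 0, and on (u₋, 0) one has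
0 < γ(u) < χ(u), the zeros of t ↦ f_t(u) on (0,∞) are exactly t = F(u) with
F(u) = (2/γ(u))·artanh(γ(u)/χ(u)), and F(u) → ∞ as u ↑ 0. -/
theorem explosion_time_case_ii_a
    (a b α β ρ v : ℝ) (ha : 0 ≤ a) (hb : 0 ≤ b) (hα : 0 < α) (hρ : |ρ| < 1) (hv : 0 < v)
    (χ γ : ℝ → ℝ) (f : ℝ → ℝ → ℝ) (um up : ℝ) (F : ℝ → ℝ)
    (hχ : ∀ u, χ u = β + u * ρ * Real.sqrt α)
    (hγ : ∀ u, γ u = Real.sqrt (χ u ^ 2 + α * u * (1 - u)))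
    (hf : ∀ t u, f t u = Real.cosh (γ u * t / 2) - (χ u / γ u) * Real.sinh (γ u * t / 2))
    (hum : um = (2 * β * ρ + Real.sqrt α
        - Real.sqrt ((2 * β * ρ + Real.sqrt α) ^ 2 + 4 * β ^ 2 * (1 - ρ ^ 2)))
        / (2 * Real.sqrt α * (1 - ρ ^ 2)))
    (hup : up = (2 * β * ρ + Real.sqrt α
        + Real.sqrt ((2 * β * ρ + Real.sqrt α) ^ 2 + 4 * β ^ 2 * (1 - ρ ^ 2)))
        / (2 * Real.sqrt α * (1 - ρ ^ 2)))
    (hF : ∀ u, F u = (2 / γ u) * ((1 / 2) * Real.log ((1 + γ u / χ u) / (1 - γ u / χ u))))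
    (hχ0 : 0 < χ 0) :
    um < 0 ∧
      (∀ u ∈ Set.Ioo um (0 : ℝ),
        (0 < γ u ∧ γ u < χ u) ∧ ∀ t : ℝ, 0 < t → (f t u = 0 ↔ t = F u)) ∧
      Tendsto F (𝓝[<] (0 : ℝ)) atTop := by
  have hβ : 0 < β := by simpa [hχ] using hχ0
  have hs : 0 < Real.sqrt α := Real.sqrt_pos.2 hα
  have hss : Real.sqrt α ^ 2 = α := Real.sq_sqrt hα.le
  have hk : 0 < 1 - ρ ^ 2 := by
    have := (sq_lt_one_iff_abs_lt_one ρ).2 hρ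
    linarith
  have hum0 : um < 0 := hum ▸ lower_root_neg hs hk hβ
  have hQ : ∀ u ∈ Ioo um (0 : ℝ), 0 < χ u ^ 2 + α * u * (1 - u) := by
    intro u hu
    have h := quadratic_pos_of_lower_root_lt hs hk (hum ▸ hu.1) hu.2
    have e : χ u ^ 2 + α * u * (1 - u) = -(Real.sqrt α ^ 2 * (1 - ρ ^ 2)) * u ^ 2
        + Real.sqrt α * (2 * β * ρ + Real.sqrt α) * u + β ^ 2 := by
      rw [hχ]
      linear_combination (u ^ 2 - u) * hss
    rwa [e]
  have hχpos : ∀ u ∈ Ioo um (0 : ℝ), 0 < χ u := by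
    intro u hu
    by_contra! hn
    -- `w` is the zero of the affine function `χ` between `u` and `0`
    have hd : 0 < β - χ u := by linarith
    have hl0 : 0 < β / (β - χ u) := div_pos hβ hd
    have hl1 : β / (β - χ u) ≤ 1 := (div_le_one hd).2 (by linarith)
    set w := β / (β - χ u) * u with hw
    have hw0 : w < 0 := mul_neg_of_pos_of_neg hl0 hu.2
    have hwu : u ≤ w := by nlinarith [hu.2]
    have hχw : χ w = 0 := by
      have h1 : χ w = β - β / (β - χ u) * (β - χ u) := by
        rw [hχ w, hw]
        linear_combination (-(β / (β - χ u))) * hχ u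
      rw [h1, div_mul_cancel₀ _ hd.ne', sub_self]
    have h := hQ w ⟨hu.1.trans_le hwu, hw0⟩
    have hneg : α * w * (1 - w) < 0 :=
      mul_neg_of_neg_of_pos (mul_neg_of_pos_of_neg hα hw0) (by linarith)
    rw [hχw] at h
    linarith
  have hγχ : ∀ u ∈ Ioo um (0 : ℝ), 0 < γ u ∧ γ u < χ u := by
    intro u hu
    have hneg : α * u * (1 - u) < 0 :=
      mul_neg_of_neg_of_pos (mul_neg_of_pos_of_neg hα hu.2) (by linarith [hu.2])
    rw [hγ]
    exact ⟨Real.sqrt_pos.2 (hQ u hu), (Real.sqrt_lt' (hχpos u hu)).2 (by linarith)⟩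
  refine ⟨hum0, fun u hu => ⟨hγχ u hu, fun t _ => ?_⟩, ?_⟩
  · obtain ⟨hg, hgc⟩ := hγχ u hu
    rw [hf, cosh_sub_div_mul_sinh_eq_zero_iff hg hgc, hF,
      div_mul_eq_mul_div 2 (γ u), eq_div_iff hg.ne', div_eq_iff two_ne_zero]
    constructor <;> intro h <;> linarith
  · have hχc : Continuous χ := by
      rw [funext hχ]
      fun_prop
    have hγc : Continuous γ := by
      rw [funext hγ]
      fun_prop
    have hχ0' : χ 0 = β := by simp [hχ]
    have hγ0 : γ 0 = β := by simp [hγ, hχ0', Real.sqrt_sq hβ.le]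
    have hγt : Tendsto γ (𝓝[<] 0) (𝓝 β) :=
      hγ0 ▸ hγc.continuousAt.tendsto.mono_left nhdsWithin_le_nhds
    have hχt : Tendsto χ (𝓝[<] 0) (𝓝 β) :=
      hχ0' ▸ hχc.continuousAt.tendsto.mono_left nhdsWithin_le_nhds
    have hrt : Tendsto (fun u => γ u / χ u) (𝓝[<] 0) (𝓝 1) := by
      have h := hγt.div hχt hβ.ne'
      rwa [div_self hβ.ne'] at h
    have hev : ∀ᶠ u in 𝓝[<] (0 : ℝ), 0 < 1 - γ u / χ u := by
      filter_upwards [Ioo_mem_nhdsLT hum0] with u hu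
      exact sub_pos.2 ((div_lt_one (hχpos u hu)).2 (hγχ u hu).2)
    have hden : Tendsto (fun u => 1 - γ u / χ u) (𝓝[<] 0) (𝓝[>] 0) :=
      tendsto_nhdsWithin_iff.2 ⟨by simpa using hrt.const_sub 1, hev⟩
    have hlog : Tendsto (fun u => Real.log ((1 + γ u / χ u) / (1 - γ u / χ u)))
        (𝓝[<] 0) atTop :=
      Real.tendsto_log_atTop.comp
        ((hrt.const_add 1).pos_mul_atTop (by norm_num) hden.inv_tendsto_nhdsGT_zero)
    rw [funext hF]
    exact (tendsto_const_nhds.div hγt hβ.ne').pos_mul_atTop (div_pos two_pos hβ)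
      (hlog.const_mul_atTop (by norm_num))
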